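/- arXiv:0807.0549 — 3 statements merged into one kernel-verified Lean document; each statement's English description precedes it below -/
import Mathlib

section
/- Let S=(I,U) be a finite connected directed network, T ⊆ U a spanning tree of S, and a : I → ℝ with ∑_{i∈I} a_i = 0. Then there exists a unique solution x̃ ∈ ℝ^U of the balance system with right-hand side a satisfying x̃_{τρ} = 0 for all (τ,ρ) ∈ U ∖ T; that is, the balance system with unknowns restricted to the tree arcs has exactly one solution. -/
open Finset

/-- The underlying undirected graph of the arc set `U ⊆ I × I`:
`i` and `j` are adjacent iff `i ≠ j` and `(i,j)` or `(j,i)` is an arc. -/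
def graphOf {I : Type*} (U : Finset (I × I)) : SimpleGraph I where
  Adj i j := i ≠ j ∧ ((i, j) ∈ U ∨ (j, i) ∈ U)
  symm := ⟨fun _ _ h => ⟨Ne.symm h.1, Or.symm h.2⟩⟩
  loopless := ⟨fun _ h => h.1 rfl⟩

/-- Left-hand side `∑_{j : (i,j) ∈ U} x_{ij} - ∑_{j : (j,i) ∈ U} x_{ji}`
of the balance equation at node `i`, for the arc set `U`. -/
def bal {I : Type*} [DecidableEq I] (U : Finset (I × I)) (x : I × I → ℝ) (i : I) : ℝ :=
  ∑ e ∈ U.filter (fun e => e.1 = i), x e - ∑ e ∈ U.filter (fun e => e.2 = i), x e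

/-- Entry of the incidence matrix in row `i` and column `e = (u,v)`:
`1` if `i = u`, `-1` if `i = v`, `0` otherwise. -/
def incEnt {I : Type*} [DecidableEq I] (i : I) (e : I × I) : ℝ :=
  if e.1 = i then 1 else if e.2 = i then -1 else 0

/-- The incidence matrix of the network with arc set `U`. -/
def incMat {I : Type*} [DecidableEq I] (U : Finset (I × I)) :
    Matrix I {e : I × I // e ∈ U} ℝ :=
  Matrix.of fun i e => incEnt i e.1

/-- The characteristic vector entailed by the arc `(τ,ρ)`, described via the walk `p`
from `ρ` back to `τ` (for a spanning tree `T` and `p` the unique path in `graphOf T`,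
the cycle `L_{τρ}` is `(τ,ρ)` followed by `p`, oriented in the direction of `(τ,ρ)`):
component `1` at `(τ,ρ)` and at every arc traversed forward by this orientation,
`-1` at every arc traversed backward, and `0` at every arc not in the cycle. -/
def charVec {I : Type*} [DecidableEq I] {G : SimpleGraph I} {ρ τ : I} (p : G.Walk ρ τ) :
    I × I → ℝ :=
  fun e =>
    if e = (τ, ρ) then 1
    else if e ∈ p.darts.map SimpleGraph.Dart.toProd then 1
    else if e.swap ∈ p.darts.map SimpleGraph.Dart.toProd then -1
    else 0

theorem mulVec_restrict {I : Type*} [Fintype I] [DecidableEq I] (U T : Finset (I × I))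
    (hTU : T ⊆ U) (x : {e : I × I // e ∈ U} → ℝ)
    (hx : ∀ e : {e : I × I // e ∈ U}, e.1 ∉ T → x e = 0) :
    (incMat U).mulVec x = (incMat T).mulVec (fun e => x ⟨e.1, hTU e.2⟩) := by
  funext i
  simp only [Matrix.mulVec, dotProduct]
  symm
  refine Fintype.sum_of_injective (fun e : {e // e ∈ T} => (⟨e.1, hTU e.2⟩ : {e // e ∈ U}))
    ?_ _ _ ?_ ?_
  · intro e f h
    have h2 := congrArg Subtype.val h
    exact Subtype.ext h2
  · intro e he
    rw [hx e, mul_zero]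
    intro h
    exact he ⟨⟨e.1, h⟩, rfl⟩
  · intro e
    simp [incMat]

theorem card_tree {I : Type*} [Fintype I] [DecidableEq I] (T : Finset (I × I))
    (hloop : ∀ e ∈ T, e.1 ≠ e.2) (hanti : ∀ e ∈ T, e.swap ∉ T) (hT : (graphOf T).IsTree) :
    T.card + 1 = Fintype.card I := by
  classical
  rw [← hT.card_edgeFinset]
  congr 1
  refine Finset.card_bij (fun e _ => s(e.1, e.2)) ?_ ?_ ?_
  · intro e he
    simp only [SimpleGraph.mem_edgeFinset, SimpleGraph.mem_edgeSet]
    exact ⟨hloop e he, Or.inl he⟩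
  · rintro ⟨a, b⟩ he ⟨c, d⟩ hf h
    simp only [Sym2.eq_iff] at h
    rcases h with ⟨rfl, rfl⟩ | ⟨rfl, rfl⟩
    · rfl
    · exact absurd hf (hanti _ he)
  · intro b
    induction b using Sym2.ind with
    | _ u v =>
      intro h
      simp only [SimpleGraph.mem_edgeFinset, SimpleGraph.mem_edgeSet] at h
      rcases h.2 with h | h
      · exact ⟨_, h, rfl⟩
      · exact ⟨_, h, Sym2.eq_swap⟩

/-- The incidence map, extended by a multiple of the unit vector at the root. -/
noncomputable def augMap {I : Type*} [Fintype I] [DecidableEq I] (T : Finset (I × I)) (r : I) :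
    (({e : I × I // e ∈ T} → ℝ) × ℝ) →ₗ[ℝ] (I → ℝ) :=
  (incMat T).mulVecLin.coprod (LinearMap.toSpanSingleton ℝ (I → ℝ) (Pi.single r 1))

theorem augMap_apply {I : Type*} [Fintype I] [DecidableEq I] (T : Finset (I × I)) (r : I)
    (x : {e : I × I // e ∈ T} → ℝ) (c : ℝ) :
    augMap T r (x, c) = (incMat T).mulVec x + c • (Pi.single r 1 : I → ℝ) := by
  simp [augMap]

theorem arc_mem {I : Type*} [Fintype I] [DecidableEq I] (T : Finset (I × I)) (r : I)
    (u v : I) (huv : u ≠ v) (h : (u, v) ∈ T) :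
    (Pi.single u 1 - Pi.single v 1 : I → ℝ) ∈ LinearMap.range (augMap T r) := by
  refine ⟨(Pi.single ⟨(u, v), h⟩ 1, 0), ?_⟩
  rw [augMap_apply]
  funext i
  simp only [Matrix.mulVec_single_one, zero_smul, add_zero, incMat, incEnt, Matrix.col_apply,
    Matrix.of_apply, Pi.sub_apply, Pi.single_apply]
  grind

theorem augMap_surj {I : Type*} [Fintype I] [DecidableEq I] (T : Finset (I × I)) (r : I)
    (hT : (graphOf T).Connected) : Function.Surjective (augMap T r) := by
  rw [← LinearMap.range_eq_top]
  have key : ∀ i, (graphOf T).Reachable i r →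
      (Pi.single i 1 : I → ℝ) ∈ LinearMap.range (augMap T r) := by
    rintro i ⟨p⟩
    induction p with
    | nil => exact ⟨(0, 1), by rw [augMap_apply]; simp⟩
    | cons h p ih =>
      rcases h.2 with h2 | h2
      · have := Submodule.add_mem _ (arc_mem T _ _ _ h.1 h2) ih
        rwa [sub_add_cancel] at this
      · have := Submodule.sub_mem _ ih (arc_mem T _ _ _ h.1.symm h2)
        rwa [sub_sub_cancel] at this
  rw [eq_top_iff]
  intro a _
  rw [pi_eq_sum_univ' a]
  refine Submodule.sum_mem _ fun i _ => Submodule.smul_mem _ _ ?_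
  convert key i (hT.preconnected i r) using 1

theorem sum_mulVec {I : Type*} [Fintype I] [DecidableEq I] (T : Finset (I × I))
    (hloop : ∀ e ∈ T, e.1 ≠ e.2) (x : {e : I × I // e ∈ T} → ℝ) :
    ∑ i, (incMat T).mulVec x i = 0 := by
  simp only [Matrix.mulVec, dotProduct]
  rw [Finset.sum_comm]
  refine Finset.sum_eq_zero fun e _ => ?_
  rw [← Finset.sum_mul]
  have h := hloop e.1 e.2
  have : ∀ i, incMat T i e = (if e.1.1 = i then 1 else 0) - (if e.1.2 = i then 1 else 0) := by
    intro i
    simp only [incMat, incEnt, Matrix.of_apply]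
    grind
  simp [this]

/-- **Remark 2.** Let `T ⊆ U` be a spanning tree of the finite connected
directed network `S = (I, U)` and `a : I → ℝ` with `∑_{i∈I} a_i = 0`. Then there exists
a unique solution `x̃ ∈ ℝ^U` of the balance system (written as `incMat U * x̃ = a`) with
`x̃_{τρ} = 0` for all `(τ,ρ) ∈ U \ T`; i.e. the balance system with unknowns restricted
to the tree arcs has exactly one solution. -/
theorem unique_tree_solution
    {I : Type*} [Fintype I] [DecidableEq I] (U : Finset (I × I))
    (hloop : ∀ e ∈ U, e.1 ≠ e.2) (hanti : ∀ e ∈ U, e.swap ∉ U)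
    (hconn : (graphOf U).Connected)
    (T : Finset (I × I)) (hTU : T ⊆ U) (hT : (graphOf T).IsTree)
    (a : I → ℝ) (ha : ∑ i : I, a i = 0) :
    ∃! x : {e : I × I // e ∈ U} → ℝ,
      (∀ e : {e : I × I // e ∈ U}, e.1 ∉ T → x e = 0) ∧
        (incMat U).mulVec x = a := by
  classical
  have hl : ∀ e ∈ T, e.1 ≠ e.2 := fun e he => hloop e (hTU he)
  have hcard := card_tree T hl (fun e he h => hanti e (hTU he) (hTU h)) hT
  obtain ⟨r⟩ := hconn.nonempty
  have hs := augMap_surj T r hT.1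
  have hi : Function.Injective (augMap T r) := by
    rw [LinearMap.injective_iff_surjective_of_finrank_eq_finrank]
    · exact hs
    · simp [hcard]
  obtain ⟨⟨y, c⟩, hy⟩ := hs a
  rw [augMap_apply] at hy
  have hc : c = 0 := by
    have h := sum_mulVec T hl y
    rw [← hy] at ha
    simpa [Finset.sum_add_distrib, h, Pi.single_apply] using ha
  subst hc
  rw [zero_smul, add_zero] at hy
  refine ⟨fun e => if h : e.1 ∈ T then y ⟨e.1, h⟩ else 0, ⟨?_, ?_⟩, ?_⟩
  · intro e he
    simp [he]
  · rw [mulVec_restrict U T hTU]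
    · simpa using hy
    · intro e he
      simp [he]
  · rintro x ⟨hx, hxa⟩
    rw [mulVec_restrict U T hTU x hx] at hxa
    have h := @hi ((fun e => x ⟨e.1, hTU e.2⟩), 0) (y, 0) (by
      rw [augMap_apply, augMap_apply, hxa, hy])
    have h1 := congrArg Prod.fst h
    funext e
    by_cases he : e.1 ∈ T
    · simpa [he] using congrFun h1 ⟨e.1, he⟩
    · simp [he, hx e he]
end

section
/- Let S=(I,U) be a finite connected directed network, T ⊆ U a spanning tree of S, a : I → ℝ, and let x̃ ∈ ℝ^U be the particular solution of the balance system with right-hand side a satisfying x̃_{τρ} = 0 for all (τ,ρ) ∈ U ∖ T. Suppose x ∈ ℝ^U solves the balance system with right-hand side a and additionally the equation ∑_{(i,j)∈U} λ_{ij} x_{ij} = α for given coefficients λ ∈ ℝ^U and α ∈ ℝ. Then ∑_{(τ,ρ)∈U∖T} R(L_{τρ}) · x_{τρ} = α − ∑_{(i,j)∈T} λ_{ij} x̃_{ij}, where R(L_{τρ}) = ∑_{(i,j)∈L_{τρ}} λ_{ij}·sign(i,j)^{L_{τρ}} is the determinant of the cycle L_{τρ} with respect to the additional equation. -/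
open Finset

theorem aux_mem {I : Type*} {T : Finset (I × I)} {u v : I} (p : (graphOf T).Walk u v)
    (e : I × I) (he : e ∈ p.darts.map SimpleGraph.Dart.toProd) : e ∈ T ∨ e.swap ∈ T := by
  obtain ⟨d, -, rfl⟩ := List.mem_map.1 he
  exact d.adj.2

/-- signed contribution of a walk -/
def wsum {I : Type*} [DecidableEq I] (T : Finset (I × I)) (lam : I × I → ℝ) {u v : I}
    (p : (graphOf T).Walk u v) : ℝ :=
  (p.darts.map (fun d => if d.toProd ∈ T then lam d.toProd else - lam d.toProd.swap)).sum

theorem aux_pot {I : Type*} [DecidableEq I] (T : Finset (I × I))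
    (hloop : ∀ e ∈ T, e.1 ≠ e.2) (hanti : ∀ e ∈ T, e.swap ∉ T)
    (hT : (graphOf T).IsTree) (lam : I × I → ℝ) :
    ∃ u : I → ℝ, ∀ e ∈ T, lam e = u e.1 - u e.2 := by
  obtain ⟨r⟩ := hT.connected.nonempty
  have hex : ∀ i, ∃ q : (graphOf T).Walk i r, q.IsPath := fun i =>
    (hT.existsUnique_path i r).exists
  choose q hq using hex
  have huniq : ∀ {i j} (p p' : (graphOf T).Walk i j), p.IsPath → p'.IsPath → p = p' :=
    fun {i j} p p' h h' => (hT.existsUnique_path i j).unique h h'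
  refine ⟨fun i => wsum T lam (q i), ?_⟩
  rintro ⟨i, j⟩ he
  have hadj : (graphOf T).Adj i j := ⟨hloop _ he, Or.inl he⟩
  have hji : (j, i) ∉ T := hanti _ he
  simp only
  by_cases hi : i ∈ (q j).support
  · have h1 : (q j).takeUntil i hi = SimpleGraph.Walk.cons hadj.symm .nil :=
      huniq _ _ ((hq j).takeUntil hi) (by simp [hadj.ne'])
    have h2 : (q j).dropUntil i hi = q i := huniq _ _ ((hq j).dropUntil hi) (hq i)
    have h3 := (q j).take_spec hi
    rw [h1, h2] at h3
    rw [← h3]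
    simp [wsum, hji]
  · have h1 : q i = SimpleGraph.Walk.cons hadj (q j) :=
      huniq _ _ (hq i) (by simp [SimpleGraph.Walk.cons_isPath_iff, hi, hq j])
    rw [h1]
    simp [wsum, he]

theorem aux_count {I : Type*} [DecidableEq I] (T : Finset (I × I))
    (hanti : ∀ e ∈ T, e.swap ∉ T) (lam : I × I → ℝ) (u : I → ℝ)
    (hu : ∀ e ∈ T, lam e = u e.1 - u e.2) {i j : I} (p : (graphOf T).Walk i j) :
    ∑ e ∈ T, lam e * (((p.darts.map SimpleGraph.Dart.toProd).count e : ℝ)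
      - ((p.darts.map SimpleGraph.Dart.toProd).count e.swap : ℝ)) = u i - u j := by
  induction p with
  | nil => simp
  | @cons a b c h p ih =>
    have key : ∑ e ∈ T, lam e * ((if (a, b) = e then (1:ℝ) else 0)
        - (if (b, a) = e then (1:ℝ) else 0)) = u a - u b := by
      simp only [mul_sub, Finset.sum_sub_distrib, mul_ite, mul_one, mul_zero, Finset.sum_ite_eq]
      rcases h.2 with h | h
      · have h' : (b, a) ∉ T := hanti _ h
        simp [h, h', hu _ h]
      · have h' : (a, b) ∉ T := hanti _ h
        simp [h, h', hu _ h]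
    have : u a - u c = (u a - u b) + (u b - u c) := by ring
    rw [this, ← key, ← ih, ← Finset.sum_add_distrib]
    refine Finset.sum_congr rfl fun e _ => ?_
    have hs : ((a, b) = e.swap) ↔ ((b, a) = e) := by
      rcases e with ⟨e1, e2⟩; simp [and_comm]
    simp only [SimpleGraph.Walk.darts_cons, List.map_cons, List.count_cons, beq_iff_eq, hs]
    push_cast
    ring

theorem aux_char {I : Type*} [DecidableEq I] (T : Finset (I × I))
    (hloop : ∀ e ∈ T, e.1 ≠ e.2) {i j : I} (p : (graphOf T).Walk i j) (hp : p.IsPath)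
    (e : I × I) (he : e ∈ T) (hne : e ≠ (j, i)) :
    charVec p e = ((p.darts.map SimpleGraph.Dart.toProd).count e : ℝ)
      - ((p.darts.map SimpleGraph.Dart.toProd).count e.swap : ℝ) := by
  have hnd : (p.darts.map SimpleGraph.Dart.edge).Nodup := hp.isTrail.edges_nodup
  have hnd2 : (p.darts.map SimpleGraph.Dart.toProd).Nodup := by
    apply List.Nodup.of_map (fun x : I × I => Sym2.mk x.1 x.2)
    rw [List.map_map]
    exact hnd
  have hboth : e ∈ p.darts.map SimpleGraph.Dart.toProd →
      e.swap ∉ p.darts.map SimpleGraph.Dart.toProd := by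
    intro h1 h2
    obtain ⟨d1, hd1, h1⟩ := List.mem_map.1 h1
    obtain ⟨d2, hd2, h2⟩ := List.mem_map.1 h2
    have : d1 = d2 := List.inj_on_of_nodup_map hnd hd1 hd2 (by
      rw [SimpleGraph.dart_edge_eq_iff]
      right
      ext1
      simp [h1, h2])
    subst this
    rw [h1] at h2
    exact hloop e he (congrArg Prod.fst h2)
  unfold charVec
  rw [if_neg hne]
  by_cases h1 : e ∈ p.darts.map SimpleGraph.Dart.toProd
  · rw [if_pos h1, List.count_eq_one_of_mem hnd2 h1, List.count_eq_zero_of_not_mem (hboth h1)]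
    simp
  · rw [if_neg h1, List.count_eq_zero_of_not_mem h1]
    by_cases h2 : e.swap ∈ p.darts.map SimpleGraph.Dart.toProd
    · rw [if_pos h2, List.count_eq_one_of_mem hnd2 h2]; simp
    · rw [if_neg h2, List.count_eq_zero_of_not_mem h2]; simp

theorem aux_bal {I : Type*} [Fintype I] [DecidableEq I] (U : Finset (I × I))
    (x : I × I → ℝ) (u : I → ℝ) :
    ∑ i, u i * bal U x i = ∑ e ∈ U, (u e.1 - u e.2) * x e := by
  simp only [bal, mul_sub, sub_mul, Finset.sum_sub_distrib, Finset.sum_filter, Finset.mul_sum]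
  congr 1 <;> (rw [Finset.sum_comm]; simp)

/-- Let `T ⊆ U` be a spanning tree of the finite connected directed
network `S = (I, U)`, `x̃` the particular solution of the balance system with right-hand
side `a` vanishing on `U \ T`, and suppose `x` solves the balance system together with
the additional equation `∑_{(i,j)∈U} λ_{ij} x_{ij} = α`. Then
`∑_{(τ,ρ)∈U∖T} R(L_{τρ})·x_{τρ} = α - ∑_{(i,j)∈T} λ_{ij} x̃_{ij}`, where
`R(L_{τρ}) = ∑_{(i,j)∈L_{τρ}} λ_{ij}·sign(i,j)^{L_{τρ}}` is the determinant of the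
cycle `L_{τρ}` (here expressed as `∑_{(i,j)∈U} λ_{ij}·sign(i,j)^{L_{τρ}}`, since the
sign vanishes off the cycle; the signs are the components of `charVec (p f)` for the
unique tree path `p f`). -/
theorem cycle_determinant_equation
    {I : Type*} [Fintype I] [DecidableEq I] (U : Finset (I × I))
    (hloop : ∀ e ∈ U, e.1 ≠ e.2) (hanti : ∀ e ∈ U, e.swap ∉ U)
    (hconn : (graphOf U).Connected)
    (T : Finset (I × I)) (hTU : T ⊆ U) (hT : (graphOf T).IsTree)
    (p : (e : I × I) → e ∈ U \ T → (graphOf T).Walk e.2 e.1)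
    (hp : ∀ (e : I × I) (he : e ∈ U \ T), (p e he).IsPath)
    (a : I → ℝ) (xt : I × I → ℝ) (hxt : ∀ i : I, bal U xt i = a i)
    (hxt0 : ∀ e ∈ U \ T, xt e = 0)
    (lam : I × I → ℝ) (α : ℝ)
    (x : I × I → ℝ) (hx : ∀ i : I, bal U x i = a i)
    (hlin : ∑ e ∈ U, lam e * x e = α) :
    ∑ f ∈ (U \ T).attach, (∑ e ∈ U, lam e * charVec (p f.1 f.2) e) * x f.1
      = α - ∑ e ∈ T, lam e * xt e := by
  have hloopT : ∀ e ∈ T, e.1 ≠ e.2 := fun e he => hloop e (hTU he)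
  have hantiT : ∀ e ∈ T, e.swap ∉ T := fun e he h => hanti e (hTU he) (hTU h)
  obtain ⟨u, hu⟩ := aux_pot T hloopT hantiT hT lam
  have hR : ∀ f (hf : f ∈ U \ T), ∑ e ∈ U, lam e * charVec (p f hf) e
      = lam f - (u f.1 - u f.2) := by
    intro f hf
    rw [← Finset.sum_sdiff hTU]
    have h1 : ∑ e ∈ U \ T, lam e * charVec (p f hf) e = lam f := by
      rw [Finset.sum_eq_single_of_mem f hf]
      · simp [charVec]
      · intro e he hne
        have heU := (Finset.mem_sdiff.1 he).1
        have heT := (Finset.mem_sdiff.1 he).2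
        have hsT : e.swap ∉ T := fun h => hanti e heU (hTU h)
        have ha : e ∉ (p f hf).darts.map SimpleGraph.Dart.toProd := fun h =>
          (aux_mem _ _ h).elim heT hsT
        have hb : e.swap ∉ (p f hf).darts.map SimpleGraph.Dart.toProd := fun h =>
          (aux_mem _ _ h).elim hsT (by simpa using heT)
        unfold charVec
        rw [if_neg hne, if_neg ha, if_neg hb, mul_zero]
    have h2 : ∑ e ∈ T, lam e * charVec (p f hf) e = u f.2 - u f.1 := by
      rw [← aux_count T hantiT lam u hu (p f hf)]
      refine Finset.sum_congr rfl fun e he => ?_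
      rw [aux_char T hloopT _ (hp f hf) e he]
      rintro rfl
      exact (Finset.mem_sdiff.1 hf).2 he
    rw [h1, h2]; ring
  have hL : ∑ f ∈ (U \ T).attach, (∑ e ∈ U, lam e * charVec (p f.1 f.2) e) * x f.1
      = ∑ f ∈ U \ T, (lam f - (u f.1 - u f.2)) * x f := by
    rw [← Finset.sum_attach (U \ T)]
    exact Finset.sum_congr rfl fun f _ => by rw [hR]
  have hA : ∑ f ∈ U \ T, (lam f - (u f.1 - u f.2)) * x f
      = ∑ f ∈ U, (lam f - (u f.1 - u f.2)) * x f := by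
    refine Finset.sum_subset Finset.sdiff_subset fun f hf hn => ?_
    have : f ∈ T := by
      by_contra h
      exact hn (Finset.mem_sdiff.2 ⟨hf, h⟩)
    rw [hu f this]; ring
  have hB : ∑ e ∈ T, lam e * xt e = ∑ e ∈ U, (u e.1 - u e.2) * xt e := by
    rw [← Finset.sum_subset hTU (f := fun e => (u e.1 - u e.2) * xt e)]
    · exact Finset.sum_congr rfl fun e he => by rw [hu e he]
    · intro e he hn
      simp [hxt0 e (Finset.mem_sdiff.2 ⟨he, hn⟩)]
  rw [hL, hA, hB, ← aux_bal, ← hlin]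
  simp only [sub_mul (lam _), Finset.sum_sub_distrib]
  rw [← aux_bal]
  simp only [hx, hxt]
end

section
/- Let S=(I,U) be a finite connected directed network, T ⊆ U a spanning tree of S, a : I → ℝ with ∑_{i∈I} a_i = 0, and consider the system consisting of the balance equations with right-hand side a together with q additional linear equations ∑_{(i,j)∈U} λ^p_{ij} x_{ij} = α_p, p = 1,…,q, where q ≤ |U| − |I| + 1. Choose a set U_C ⊆ U ∖ T of q cyclic arcs and set U_N = U ∖ (T ∪ U_C). If the q×q matrix D = ( R_p(L_e) )_{p=1,…,q; e ∈ U_C} of cycle determinants R_p(L_e) = ∑_{(i,j)∈L_e} λ^p_{ij}·sign(i,j)^{L_e} is nonsingular, then for every assignment of real values (x_e)_{e∈U_N} to the variables on U_N there exists a unique solution x ∈ ℝ^U of the full system whose components on U_N equal the assigned values. -/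
open Finset

noncomputable def walkFlow {I : Type*} [DecidableEq I] {G : SimpleGraph I} {u v : I}
    (w : G.Walk u v) (e : I × I) : ℝ :=
  ((w.darts.map SimpleGraph.Dart.toProd).count e : ℝ)
    - ((w.darts.map SimpleGraph.Dart.toProd).count e.swap : ℝ)

lemma incEnt_eq {I : Type*} [DecidableEq I] (i : I) (e : I × I) (h : e.1 ≠ e.2) :
    incEnt i e = (if e.1 = i then 1 else 0) - (if e.2 = i then 1 else 0) := by
  unfold incEnt
  split_ifs <;> simp_all

lemma walkFlow_bal {I : Type*} [DecidableEq I] (U T : Finset (I × I))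
    (hloop : ∀ e ∈ U, e.1 ≠ e.2) (hanti : ∀ e ∈ U, e.swap ∉ U) (hTU : T ⊆ U) (i : I)
    {u v : I} (w : (graphOf T).Walk u v) :
    ∑ e ∈ U, incEnt i e * walkFlow w e = (if u = i then 1 else 0) - (if v = i then 1 else 0) := by
  induction w with
  | nil => simp [walkFlow]
  | @cons a b c h w ih =>
    have h1 : ∀ e, walkFlow (SimpleGraph.Walk.cons h w) e = walkFlow w e +
        ((if e = (a, b) then 1 else 0) - (if e = (b, a) then 1 else 0)) := by
      intro e
      have h2 : ((a, b) = e.swap) ↔ (e = (b, a)) := by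
        rcases e with ⟨x, y⟩
        simp only [Prod.swap_prod_mk, Prod.mk.injEq]
        constructor <;> rintro ⟨rfl, rfl⟩ <;> simp
      simp only [walkFlow, SimpleGraph.Walk.darts_cons, List.map_cons, List.count_cons, beq_iff_eq,
        h2, eq_comm (a := (a, b)) (b := e)]
      push_cast
      ring
    simp only [h1, mul_add, Finset.sum_add_distrib, ih, mul_sub, Finset.sum_sub_distrib, mul_ite,
      mul_one, mul_zero, Finset.sum_ite_eq']
    rcases h with ⟨hne, h | h⟩
    · have h3 := hTU h
      have h4 : (b, a) ∉ U := hanti _ h3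
      rw [if_pos h3, if_neg h4, incEnt_eq _ _ (hloop _ h3)]
      simp
    · have h3 := hTU h
      have h4 : (a, b) ∉ U := hanti _ h3
      rw [if_pos h3, if_neg h4, incEnt_eq _ _ (hloop _ h3)]
      simp

lemma dart_arc {I : Type*} [DecidableEq I] (U T : Finset (I × I))
    (hanti : ∀ e ∈ U, e.swap ∉ U) (hTU : T ⊆ U) (e : I × I) (he : e ∈ U) (heT : e ∉ T)
    {u v : I} (w : (graphOf T).Walk u v) :
    e ∉ w.darts.map SimpleGraph.Dart.toProd ∧ e.swap ∉ w.darts.map SimpleGraph.Dart.toProd := by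
  constructor
  · intro h
    obtain ⟨d, -, rfl⟩ := List.mem_map.1 h
    rcases d.adj with ⟨-, h | h⟩
    · exact heT h
    · exact hanti _ he (hTU h)
  · intro h
    obtain ⟨d, -, h0⟩ := List.mem_map.1 h
    have h1 : d.toProd.1 = e.2 := by rw [h0]; rfl
    have h2 : d.toProd.2 = e.1 := by rw [h0]; rfl
    rcases d.adj with ⟨-, h | h⟩ <;> rw [h1, h2] at h
    · exact hanti _ he (hTU h)
    · exact heT h

lemma walkFlow_supp {I : Type*} [DecidableEq I] (U T : Finset (I × I))
    (hanti : ∀ e ∈ U, e.swap ∉ U) (hTU : T ⊆ U) (e : I × I) (he : e ∈ U) (heT : e ∉ T)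
    {u v : I} (w : (graphOf T).Walk u v) : walkFlow w e = 0 := by
  obtain ⟨h1, h2⟩ := dart_arc U T hanti hTU e he heT w
  simp only [walkFlow, List.count_eq_zero_of_not_mem h1, List.count_eq_zero_of_not_mem h2]
  simp

lemma path_counts {I : Type*} [DecidableEq I] {G : SimpleGraph I}
    {u v : I} (w : G.Walk u v) (hw : w.IsPath) (e : I × I) :
    (w.darts.map SimpleGraph.Dart.toProd).count e +
      (w.darts.map SimpleGraph.Dart.toProd).count e.swap ≤ 1 := by
  by_cases hee : e = e.swap
  · have : (w.darts.map SimpleGraph.Dart.toProd).count e = 0 := by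
      apply List.count_eq_zero_of_not_mem
      intro h
      obtain ⟨d, -, rfl⟩ := List.mem_map.1 h
      exact d.adj.ne (congrArg Prod.fst hee)
    rw [← hee, this]; simp
  have h := List.nodup_iff_count_le_one.1 hw.isTrail.edges_nodup (Sym2.mk e.1 e.2)
  have key : ∀ l : List G.Dart, (l.map SimpleGraph.Dart.toProd).count e +
      (l.map SimpleGraph.Dart.toProd).count e.swap ≤
      (l.map SimpleGraph.Dart.edge).count (Sym2.mk e.1 e.2) := by
    intro l
    induction l with
    | nil => simp
    | cons d l ih =>
      simp only [List.map_cons, List.count_cons, beq_iff_eq]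
      have h1 : d.toProd = e → d.edge = Sym2.mk e.1 e.2 := by rintro rfl; rfl
      have h2 : d.toProd = e.swap → d.edge = Sym2.mk e.1 e.2 := by
        intro h
        have : d.edge = Sym2.mk d.toProd.1 d.toProd.2 := rfl
        rw [this, h]; exact Sym2.eq_swap
      by_cases ha : d.toProd = e
      · have hb : ¬ d.toProd = e.swap := fun hb => hee (ha.symm.trans hb)
        rw [if_pos ha, if_neg hb, if_pos (h1 ha)]; omega
      · by_cases hb : d.toProd = e.swap
        · rw [if_neg ha, if_pos hb, if_pos (h2 hb)]; omega
        · rw [if_neg ha, if_neg hb]; omega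
  exact (key _).trans h

lemma charVec_eq {I : Type*} [DecidableEq I] (U T : Finset (I × I))
    (hanti : ∀ e ∈ U, e.swap ∉ U) (hTU : T ⊆ U) {f : I × I} (hf : f ∈ U \ T)
    (w : (graphOf T).Walk f.2 f.1) (hw : w.IsPath) (e : I × I) :
    charVec w e = (if e = f then 1 else 0) + walkFlow w e := by
  have hff : (f.1, f.2) = f := rfl
  obtain ⟨hfU, hfT⟩ := Finset.mem_sdiff.1 hf
  unfold charVec
  rw [hff]
  by_cases h : e = f
  · subst h
    rw [if_pos rfl, if_pos rfl, walkFlow_supp U T hanti hTU e hfU hfT, add_zero]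
  rw [if_neg h, if_neg h, zero_add]
  have hc := path_counts w hw e
  unfold walkFlow
  by_cases h1 : e ∈ w.darts.map SimpleGraph.Dart.toProd
  · have := List.count_pos_iff.2 h1
    rw [if_pos h1, show (w.darts.map SimpleGraph.Dart.toProd).count e = 1 by omega,
      show (w.darts.map SimpleGraph.Dart.toProd).count e.swap = 0 by omega]
    simp
  · rw [if_neg h1, List.count_eq_zero_of_not_mem h1]
    by_cases h2 : e.swap ∈ w.darts.map SimpleGraph.Dart.toProd
    · have := List.count_pos_iff.2 h2
      rw [if_pos h2, show (w.darts.map SimpleGraph.Dart.toProd).count e.swap = 1 by omega]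
      simp
    · rw [if_neg h2, List.count_eq_zero_of_not_mem h2]
      simp

/-- A flow with zero balance supported on the tree vanishes. -/
lemma tree_inj {I : Type*} [Fintype I] [DecidableEq I] (U T : Finset (I × I))
    (hloop : ∀ e ∈ U, e.1 ≠ e.2) (hanti : ∀ e ∈ U, e.swap ∉ U) (hTU : T ⊆ U)
    (hT : (graphOf T).IsTree) (x : I × I → ℝ)
    (hx : ∀ i, ∑ e ∈ U, incEnt i e * x e = 0) (hs : ∀ e ∈ U, e ∉ T → x e = 0) :
    ∀ e ∈ U, x e = 0 := by
  classical
  intro f hfU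
  by_cases hfT : f ∉ T
  · exact hs f hfU hfT
  rw [not_not] at hfT
  have hadj : (graphOf T).Adj f.1 f.2 := ⟨hloop f hfU, Or.inl hfT⟩
  have hbr := (SimpleGraph.isAcyclic_iff_forall_adj_isBridge.1 hT.isAcyclic) hadj
  rw [SimpleGraph.isBridge_iff] at hbr
  set G := graphOf T \ SimpleGraph.fromEdgeSet {s(f.1, f.2)} with hG
  let y : I → ℝ := fun i => if G.Reachable f.1 i then 1 else 0
  have h0 : ∑ i, y i * ∑ e ∈ U, incEnt i e * x e = 0 := by simp [hx]
  have h1 : ∑ i, y i * ∑ e ∈ U, incEnt i e * x e = ∑ e ∈ U, (y e.1 - y e.2) * x e := by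
    simp_rw [Finset.mul_sum]
    rw [Finset.sum_comm]
    refine Finset.sum_congr rfl fun e he => ?_
    simp_rw [← mul_assoc, incEnt_eq _ e (hloop e he)]
    rw [← Finset.sum_mul]
    simp [mul_sub]
  rw [h1, Finset.sum_eq_single f] at h0
  · have e1 : y f.1 = 1 := if_pos (SimpleGraph.Reachable.refl _)
    have e2 : y f.2 = 0 := if_neg hbr
    rw [e1, e2] at h0
    simpa using h0
  · intro e he hef
    by_cases heT : e ∈ T
    · have hGa : G.Adj e.1 e.2 := by
        rw [hG, SimpleGraph.sdiff_adj]
        refine ⟨⟨hloop e he, Or.inl heT⟩, ?_⟩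
        rw [SimpleGraph.fromEdgeSet_adj]
        rintro ⟨h, -⟩
        rcases Sym2.eq_iff.1 (Set.mem_singleton_iff.1 h) with ⟨ha, hb⟩ | ⟨ha, hb⟩
        · exact hef (Prod.ext ha hb)
        · apply hanti e he
          have : e.swap = f := Prod.ext hb ha
          rwa [this]
      have : y e.1 = y e.2 := by
        simp only [y]
        have : G.Reachable f.1 e.1 ↔ G.Reachable f.1 e.2 :=
          ⟨fun h => h.trans hGa.reachable, fun h => h.trans hGa.symm.reachable⟩
        simp only [this]
      rw [this]; simp
    · rw [hs e he heT]; simp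
  · intro h; exact absurd hfU h

/-- Every balanced right-hand side is attained by a flow supported on the tree. -/
lemma tree_surj {I : Type*} [Fintype I] [DecidableEq I] (U T : Finset (I × I))
    (hloop : ∀ e ∈ U, e.1 ≠ e.2) (hanti : ∀ e ∈ U, e.swap ∉ U) (hTU : T ⊆ U)
    (hT : (graphOf T).IsTree) (a : I → ℝ) (ha : ∑ i, a i = 0) :
    ∃ x : I × I → ℝ, (∀ i, ∑ e ∈ U, incEnt i e * x e = a i) ∧
      (∀ e ∈ U, e ∉ T → x e = 0) := by
  obtain ⟨r⟩ := hT.connected.nonempty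
  have hw : ∀ j, Nonempty ((graphOf T).Walk j r) := fun j => hT.connected.preconnected j r
  let w : ∀ j, (graphOf T).Walk j r := fun j => (hw j).some
  refine ⟨fun e => ∑ j, a j * walkFlow (w j) e, fun i => ?_, fun e he heT => ?_⟩
  · simp_rw [Finset.mul_sum]
    rw [Finset.sum_comm]
    have : ∀ j, ∑ e ∈ U, incEnt i e * (a j * walkFlow (w j) e) =
        a j * ((if j = i then 1 else 0) - (if r = i then 1 else 0)) := by
      intro j
      rw [← walkFlow_bal U T hloop hanti hTU i (w j), Finset.mul_sum]
      exact Finset.sum_congr rfl fun e _ => by ring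
    simp_rw [this, mul_sub]
    rw [Finset.sum_sub_distrib, ← Finset.sum_mul, ha]
    simp
  · exact Finset.sum_eq_zero fun j _ => by
      rw [walkFlow_supp U T hanti hTU e he heT, mul_zero]

/-- **Decomposition of the system.** Let `T ⊆ U` be a spanning tree of
the finite connected directed network `S = (I, U)`, `a : I → ℝ` with `∑ a_i = 0`, and
consider the balance system together with `q` additional equations
`∑_{(i,j)∈U} λ^p_{ij} x_{ij} = α_p`, `p = 1,…,q`, where `q ≤ |U| - |I| + 1` (stated
additively). Choose a set `C ⊆ U \ T` of `q` cyclic arcs (enumerated by the bijection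
`σ : Fin q ≃ C`) and put `N = (U \ T) \ C`. If the `q × q` matrix
`D = (R_p(L_e))_{p,e∈C}` of cycle determinants
`R_p(L_e) = ∑_{(i,j)∈L_e} λ^p_{ij}·sign(i,j)^{L_e}` is nonsingular, then for every
assignment `v` of real values to the variables on `N` there is a unique solution of the
full system whose components on `N` equal the assigned values. -/
theorem decomposition_unique_solution
    {I : Type*} [Fintype I] [DecidableEq I] (U : Finset (I × I))
    (hloop : ∀ e ∈ U, e.1 ≠ e.2) (hanti : ∀ e ∈ U, e.swap ∉ U)
    (hconn : (graphOf U).Connected)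
    (T : Finset (I × I)) (hTU : T ⊆ U) (hT : (graphOf T).IsTree)
    (p : (e : I × I) → e ∈ U \ T → (graphOf T).Walk e.2 e.1)
    (hp : ∀ (e : I × I) (he : e ∈ U \ T), (p e he).IsPath)
    (a : I → ℝ) (ha : ∑ i : I, a i = 0)
    (q : ℕ) (hq : q + Fintype.card I ≤ U.card + 1)
    (lam : Fin q → I × I → ℝ) (α : Fin q → ℝ)
    (C : Finset (I × I)) (hC : C ⊆ U \ T)
    (σ : Fin q ≃ {e : I × I // e ∈ C})
    (hD : (Matrix.of fun (pi t : Fin q) =>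
        ∑ e ∈ U, lam pi e * charVec (p (σ t).1 (hC (σ t).2)) e).det ≠ 0)
    (v : I × I → ℝ) :
    ∃! x : {e : I × I // e ∈ U} → ℝ,
      (incMat U).mulVec x = a ∧
      (∀ pi : Fin q, ∑ e : {e : I × I // e ∈ U}, lam pi e.1 * x e = α pi) ∧
      (∀ e : {e : I × I // e ∈ U}, e.1 ∈ (U \ T) \ C → x e = v e.1) := by
  classical
  let z : Fin q → I × I → ℝ := fun t => charVec (p (σ t).1 (hC (σ t).2))
  have hz : ∀ t e, z t e = (if e = (σ t).1 then 1 else 0) +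
      walkFlow (p (σ t).1 (hC (σ t).2)) e := fun t e =>
    charVec_eq U T hanti hTU (hC (σ t).2) _ (hp _ _) e
  have hzs : ∀ t, ∀ e ∈ U, e ∉ T → z t e = if e = (σ t).1 then 1 else 0 := by
    intro t e he heT
    rw [hz, walkFlow_supp U T hanti hTU e he heT, add_zero]
  have hzb : ∀ t i, ∑ e ∈ U, incEnt i e * z t e = 0 := by
    intro t i
    have hU : (σ t).1 ∈ U := (Finset.mem_sdiff.1 (hC (σ t).2)).1
    simp_rw [hz, mul_add]
    rw [Finset.sum_add_distrib, walkFlow_bal U T hloop hanti hTU i]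
    simp only [mul_ite, mul_one, mul_zero, Finset.sum_ite_eq', if_pos hU]
    rw [incEnt_eq _ _ (hloop _ hU)]
    ring
  set D : Matrix (Fin q) (Fin q) ℝ := Matrix.of fun (pi t : Fin q) =>
        ∑ e ∈ U, lam pi e * charVec (p (σ t).1 (hC (σ t).2)) e with hDdef
  have hDz : ∀ pi t, D pi t = ∑ e ∈ U, lam pi e * z t e := fun _ _ => rfl
  -- sums of a functional over combinations of cycles
  have hcomb : ∀ (g : I × I → ℝ) (c : Fin q → ℝ),
      ∑ e ∈ U, g e * ∑ t, c t * z t e = ∑ t, c t * ∑ e ∈ U, g e * z t e := by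
    intro g c
    simp_rw [Finset.mul_sum]
    rw [Finset.sum_comm]
    exact Finset.sum_congr rfl fun t _ => Finset.sum_congr rfl fun e _ => by ring
  have hcN : ∀ (c : Fin q → ℝ), ∀ e ∈ U, e ∉ T → e ∉ C → ∑ t, c t * z t e = 0 := by
    intro c e he heT heC
    refine Finset.sum_eq_zero fun t _ => ?_
    rw [hzs t e he heT, if_neg, mul_zero]
    rintro rfl
    exact heC (σ t).2
  have hcC : ∀ (c : Fin q → ℝ) (s : Fin q), ∑ t, c t * z t (σ s).1 = c s := by
    intro c s
    obtain ⟨hU, hT'⟩ := Finset.mem_sdiff.1 (hC (σ s).2)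
    have : ∀ t, z t (σ s).1 = if t = s then 1 else 0 := by
      intro t
      rw [hzs t _ hU hT']
      refine if_congr ?_ rfl rfl
      rw [← Subtype.ext_iff, σ.injective.eq_iff, eq_comm]
    simp [this]
  -- existence
  have hex : ∃ x : I × I → ℝ, (∀ i, ∑ e ∈ U, incEnt i e * x e = a i) ∧
      (∀ pi, ∑ e ∈ U, lam pi e * x e = α pi) ∧ (∀ e ∈ (U \ T) \ C, x e = v e) := by
    let vN : I × I → ℝ := fun e => if e ∈ (U \ T) \ C then v e else 0
    obtain ⟨x1, hx1, hx1s⟩ := tree_surj U T hloop hanti hTU hT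
      (fun i => a i - ∑ e ∈ U, incEnt i e * vN e) (by
        rw [Finset.sum_sub_distrib, ha, Finset.sum_comm, zero_sub, neg_eq_zero]
        refine Finset.sum_eq_zero fun e he => ?_
        rw [← Finset.sum_mul]
        simp [incEnt_eq _ e (hloop e he)])
    let x0 : I × I → ℝ := fun e => x1 e + vN e
    let c : Fin q → ℝ := D⁻¹.mulVec (fun pi => α pi - ∑ e ∈ U, lam pi e * x0 e)
    have hc : D.mulVec c = fun pi => α pi - ∑ e ∈ U, lam pi e * x0 e := by
      simp only [c]
      rw [Matrix.mulVec_mulVec, Matrix.mul_nonsing_inv _ (isUnit_iff_ne_zero.2 hD),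
        Matrix.one_mulVec]
    refine ⟨fun e => x0 e + ∑ t, c t * z t e, fun i => ?_, fun pi => ?_, fun e he => ?_⟩
    · simp_rw [mul_add]
      rw [Finset.sum_add_distrib, hcomb]
      simp only [hzb, mul_zero, Finset.sum_const_zero, add_zero, x0, mul_add,
        Finset.sum_add_distrib, hx1]
      ring
    · simp_rw [mul_add]
      rw [Finset.sum_add_distrib, hcomb]
      have h := congrFun hc pi
      simp only [Matrix.mulVec, dotProduct, hDz] at h
      simp_rw [mul_comm (c _)]
      rw [h]; ring
    · obtain ⟨h1, h2⟩ := Finset.mem_sdiff.1 he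
      obtain ⟨h3, h4⟩ := Finset.mem_sdiff.1 h1
      simp only [hcN c e h3 h4 h2, x0, vN, hx1s e h3 h4, if_pos he]
      ring
  -- uniqueness
  have huniq : ∀ d : I × I → ℝ, (∀ i, ∑ e ∈ U, incEnt i e * d e = 0) →
      (∀ pi, ∑ e ∈ U, lam pi e * d e = 0) → (∀ e ∈ (U \ T) \ C, d e = 0) →
      ∀ e ∈ U, d e = 0 := by
    intro d hd1 hd2 hd3
    let c : Fin q → ℝ := fun t => d (σ t).1
    have h1 := tree_inj U T hloop hanti hTU hT (fun e => d e - ∑ t, c t * z t e) (by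
      intro i
      simp_rw [mul_sub]
      rw [Finset.sum_sub_distrib, hcomb, hd1]
      simp [hzb]) (by
      intro e he heT
      by_cases heC : e ∈ C
      · obtain ⟨s, hs⟩ := σ.surjective ⟨e, heC⟩
        have : e = (σ s).1 := by rw [hs]
        subst this
        simp only [hcC]
        simp [c]
      · simp only [hcN c e he heT heC]
        rw [hd3 e (by simp [he, heT, heC]), sub_zero])
    have h2 : ∀ e ∈ U, d e = ∑ t, c t * z t e := fun e he => sub_eq_zero.1 (h1 e he)
    have h3 : D.mulVec c = 0 := by
      funext pi
      simp only [Matrix.mulVec, dotProduct, hDz, Pi.zero_apply]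
      simp_rw [mul_comm _ (c _)]
      rw [← hcomb, ← hd2 pi]
      exact Finset.sum_congr rfl fun e he => by rw [h2 e he]
    have h4 : c = 0 := Matrix.eq_zero_of_mulVec_eq_zero hD h3
    intro e he
    rw [h2 e he, h4]; simp
  have hsub : ∀ (g x : I × I → ℝ), ∑ e : {e : I × I // e ∈ U}, g e.1 * x e.1 =
      ∑ e ∈ U, g e * x e := fun g x => Finset.sum_coe_sort U (fun e => g e * x e)
  obtain ⟨x, hx1, hx2, hx3⟩ := hex
  refine ⟨fun e => x e.1, ⟨?_, fun pi => ?_, fun e he => hx3 _ he⟩, ?_⟩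
  · funext i
    exact (hsub (incEnt i) x).trans (hx1 i)
  · exact (hsub (lam pi) x).trans (hx2 pi)
  · rintro y ⟨hy1, hy2, hy3⟩
    let y' : I × I → ℝ := fun e => if h : e ∈ U then y ⟨e, h⟩ else 0
    have hyy : ∀ e : {e : I × I // e ∈ U}, y e = y' e.1 := by
      intro e; simp [y']
    have := huniq (fun e => y' e - x e) (by
      intro i
      simp_rw [mul_sub]
      rw [Finset.sum_sub_distrib, hx1, sub_eq_zero, ← hsub, ← congrFun hy1 i]
      simp only [← hyy]
      rfl) (by
      intro pi
      simp_rw [mul_sub]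
      rw [Finset.sum_sub_distrib, hx2, sub_eq_zero, ← hsub, ← hy2 pi]
      simp only [← hyy]) (by
      intro e he
      have hU : e ∈ U := (Finset.mem_sdiff.1 (Finset.mem_sdiff.1 he).1).1
      have := hy3 ⟨e, hU⟩ he
      rw [hyy] at this
      rw [this, hx3 e he, sub_self])
    funext e
    rw [hyy]
    exact sub_eq_zero.1 (this e.1 e.2)
end
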